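/- Let C > 0 and 0 < α < 1 be given. If 2M · sup_{t∈ℝ} ∫_{−∞}^{∞} |𝒢(t,s)| ε(s)^α Δ₃(s,t)^α ds ≤ C, then the map h̄ from the conjugacy H̄(t,x,y) = (x + h̄(t,x,y), y) satisfies |h̄(t,x,y₁) − h̄(t,x,y₂)| ≤ C |y₁ − y₂|^α for all t ∈ ℝ, x ∈ X and y₁, y₂ ∈ Y. -/

import Mathlib

open MeasureTheory

/-- The Green function `𝒢(t,s)`. -/
noncomputable def Green {X : Type*} [NormedAddCommGroup X] [NormedSpace ℝ X]
    (T : ℝ → ℝ → X →L[ℝ] X) (P : ℝ → X →L[ℝ] X) (t s : ℝ) : X →L[ℝ] X :=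
  if s ≤ t then (T t s).comp (P s)
  else -((T t s).comp (ContinuousLinearMap.id ℝ X - P s))

/-- `T` is the evolution family of `ẋ = A(t)x`. -/
def IsEvolutionFamily {X : Type*} [NormedAddCommGroup X] [NormedSpace ℝ X]
    (A : ℝ → X →L[ℝ] X) (T : ℝ → ℝ → X →L[ℝ] X) : Prop :=
  (∀ s ξ t, HasDerivAt (fun r => T r s ξ) (A t (T t s ξ)) t) ∧
  (∀ s, T s s = ContinuousLinearMap.id ℝ X) ∧
  (∀ t r s, (T t r).comp (T r s) = T t s)

/-- `(x, y)` is a solution of the coupled system `ẋ = A(t)x + f(t,x,y)`, `ẏ = g(t,y)`. -/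
def IsSolNL {X Y : Type*} [NormedAddCommGroup X] [NormedSpace ℝ X]
    [NormedAddCommGroup Y] [NormedSpace ℝ Y]
    (A : ℝ → X →L[ℝ] X) (f : ℝ → X → Y → X) (g : ℝ → Y → Y)
    (x : ℝ → X) (y : ℝ → Y) : Prop :=
  (∀ t, HasDerivAt x (A t (x t) + f t (x t) (y t)) t) ∧
  (∀ t, HasDerivAt y (g t (y t)) t)

theorem IsEvolutionFamily.continuous_left {X : Type*} [NormedAddCommGroup X] [NormedSpace ℝ X]
    [CompleteSpace X] {A : ℝ → X →L[ℝ] X} (hA : Continuous A) {T : ℝ → ℝ → X →L[ℝ] X}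
    (hT : IsEvolutionFamily A T) (t : ℝ) : Continuous fun s => T s t := by
  rw [continuous_iff_continuousAt]
  intro r
  have hcont : ∀ ξ, Continuous fun s => T s t ξ := fun ξ =>
    continuous_iff_continuousAt.2 fun s => (hT.1 t ξ s).continuousAt
  have hI : IsCompact (Set.Icc (r - 1) (r + 1)) := isCompact_Icc
  obtain ⟨a, ha⟩ := hI.exists_bound_of_continuousOn hA.continuousOn
  obtain ⟨B, hB⟩ : ∃ B, ∀ s : Set.Icc (r - 1) (r + 1), ‖T s t‖ ≤ B := by
    refine banach_steinhaus fun ξ => ?_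
    obtain ⟨c, hc⟩ := hI.exists_bound_of_continuousOn (hcont ξ).continuousOn
    exact ⟨c, fun s => hc s s.2⟩
  have hr : r ∈ Set.Icc (r - 1) (r + 1) := ⟨by linarith, by linarith⟩
  have ha0 : 0 ≤ a := (norm_nonneg _).trans (ha r hr)
  have hB0 : 0 ≤ B := (norm_nonneg _).trans (hB ⟨r, hr⟩)
  have key : ∀ s ∈ Set.Icc (r - 1) (r + 1), ‖T s t - T r t‖ ≤ a * B * ‖s - r‖ := by
    intro s hs
    refine ContinuousLinearMap.opNorm_le_bound _ (by positivity) fun ξ => ?_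
    have := (convex_Icc (r - 1) (r + 1)).norm_image_sub_le_of_norm_hasDerivWithin_le
      (f := fun u => T u t ξ) (C := a * B * ‖ξ‖)
      (fun u _ => (hT.1 t ξ u).hasDerivWithinAt) (fun u hu => by
        have h1 : ‖T u t ξ‖ ≤ B * ‖ξ‖ := (T u t).le_of_opNorm_le (hB ⟨u, hu⟩) ξ
        calc ‖A u (T u t ξ)‖ ≤ a * ‖T u t ξ‖ := (A u).le_of_opNorm_le (ha u hu) _
          _ ≤ a * (B * ‖ξ‖) := by gcongr
          _ = a * B * ‖ξ‖ := by ring) hr hs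
    simpa [mul_right_comm] using this
  rw [ContinuousAt, tendsto_iff_norm_sub_tendsto_zero]
  have hlim : Filter.Tendsto (fun s : ℝ => a * B * ‖s - r‖) (nhds r) (nhds 0) := by
    have : Continuous fun s : ℝ => a * B * ‖s - r‖ := by fun_prop
    simpa using this.tendsto r
  refine squeeze_zero' (Filter.Eventually.of_forall fun _ => norm_nonneg _) ?_ hlim
  filter_upwards [Icc_mem_nhds (show r - 1 < r by linarith) (show r < r + 1 by linarith)]
    with s hs using key s hs

theorem IsEvolutionFamily.continuous_right {X : Type*} [NormedAddCommGroup X] [NormedSpace ℝ X]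
    [CompleteSpace X] {A : ℝ → X →L[ℝ] X} (hA : Continuous A) {T : ℝ → ℝ → X →L[ℝ] X}
    (hT : IsEvolutionFamily A T) (t : ℝ) : Continuous fun s => T t s := by
  let u : ℝ → (X →L[ℝ] X)ˣ := fun s =>
    ⟨T s t, T t s, (hT.2.2 s t s).trans (hT.2.1 s), (hT.2.2 t s t).trans (hT.2.1 t)⟩
  have hinv : (fun s => T t s) = fun s => Ring.inverse (T s t) := by
    funext s
    exact (Ring.inverse_unit (u s)).symm
  rw [hinv, continuous_iff_continuousAt]
  intro s
  exact ContinuousAt.comp (f := fun s => T s t) (NormedRing.inverse_continuousAt (u s))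
    (hT.continuous_left hA t).continuousAt

theorem stronglyMeasurable_green {X : Type*} [NormedAddCommGroup X] [NormedSpace ℝ X]
    [CompleteSpace X] {A : ℝ → X →L[ℝ] X} (hA : Continuous A) {T : ℝ → ℝ → X →L[ℝ] X}
    (hT : IsEvolutionFamily A T) {P : ℝ → X →L[ℝ] X} (hP : StronglyMeasurable P) (t : ℝ) :
    StronglyMeasurable (Green T P t) := by
  have hTm : StronglyMeasurable fun s => T t s := (hT.continuous_right hA t).stronglyMeasurable
  have hcomp : ∀ {Q : ℝ → X →L[ℝ] X}, StronglyMeasurable Q →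
      StronglyMeasurable fun s => (T t s).comp (Q s) := fun hQ =>
    isBoundedBilinearMap_comp.continuous.comp_stronglyMeasurable (hTm.prodMk hQ)
  exact StronglyMeasurable.ite (measurableSet_Iic (a := t)) (hcomp hP)
    (hcomp (stronglyMeasurable_const.sub hP)).neg

theorem integrable_green_apply {X : Type*} [NormedAddCommGroup X] [NormedSpace ℝ X]
    [CompleteSpace X] {A : ℝ → X →L[ℝ] X} (hA : Continuous A) {T : ℝ → ℝ → X →L[ℝ] X}
    (hT : IsEvolutionFamily A T) {P : ℝ → X →L[ℝ] X} (hP : StronglyMeasurable P) {t : ℝ}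
    (hG : Integrable fun s => ‖Green T P t s‖) {v : ℝ → X} (hv : Continuous v) {M : ℝ}
    (hM : ∀ s, ‖v s‖ ≤ M) : Integrable fun s => Green T P t s (v s) := by
  refine (hG.mul_const M).mono' ?_ (Filter.Eventually.of_forall fun s =>
    (Green T P t s).le_opNorm_of_le (hM s))
  exact (isBoundedBilinearMap_apply.continuous.comp_stronglyMeasurable
    ((stronglyMeasurable_green hA hT hP t).prodMk hv.stronglyMeasurable)).aestronglyMeasurable

theorem Real.le_mul_rpow_of_le_of_le {a b m α : ℝ} (ha : 0 ≤ a) (hm : 1 ≤ m) (ham : a ≤ m)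
    (hab : a ≤ b) (hα0 : 0 ≤ α) (hα1 : α ≤ 1) : a ≤ m * b ^ α := by
  calc a = a ^ (1 - α) * a ^ α := by
        rw [← Real.rpow_add_of_nonneg ha (by linarith) hα0]; simp
    _ ≤ m ^ (1 - α) * b ^ α := by gcongr
    _ ≤ m * b ^ α := by
        gcongr
        · exact Real.rpow_nonneg (ha.trans hab) _
        · exact Real.rpow_le_self_of_one_le hm (by linarith)

theorem holder_continuity_hbar_in_y
    {X Y : Type*} [NormedAddCommGroup X] [NormedSpace ℝ X] [CompleteSpace X]
    [NormedAddCommGroup Y] [NormedSpace ℝ Y] [CompleteSpace Y]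
    (A : ℝ → X →L[ℝ] X) (hA : Continuous A)
    (T : ℝ → ℝ → X →L[ℝ] X) (hT : IsEvolutionFamily A T)
    (f : ℝ → X → Y → X) (hf : Continuous fun p : ℝ × X × Y => f p.1 p.2.1 p.2.2)
    (g : ℝ → Y → Y) (hg : Continuous fun p : ℝ × Y => g p.1 p.2)
    -- `Φ` is the flow of `ẏ = g(t,y)`; solutions are global and unique
    (Φ : ℝ → ℝ → Y → Y)
    (hΦ : ∀ (τ : ℝ) (η : Y),
      (∀ t, HasDerivAt (fun r => Φ r τ η) (g t (Φ t τ η)) t) ∧ Φ τ τ η = η)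
    (hgU : ∀ y w : ℝ → Y, (∀ t, HasDerivAt y (g t (y t)) t) →
      (∀ t, HasDerivAt w (g t (w t)) t) → ∀ τ, y τ = w τ → y = w)
    -- `Ψ` is the `x`-component of the flow of the coupled system (2nl)
    (Ψ : ℝ → ℝ → X → Y → X)
    (hΨ : ∀ (τ : ℝ) (ξ : X) (η : Y),
      IsSolNL A f g (fun t => Ψ t τ ξ η) (fun t => Φ t τ η) ∧ Ψ τ τ ξ η = ξ)
    (P : ℝ → X →L[ℝ] X) (hP : StronglyMeasurable P)
    -- the bound `Δ₃` on differences of solutions of (2nl) agreeing in `x` at time `s`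
    (Δ₃ : ℝ → ℝ → ℝ) (hΔ₃c : Continuous fun p : ℝ × ℝ => Δ₃ p.1 p.2)
    (hΔ₃pos : ∀ t s, 0 < Δ₃ t s)
    (hΔ₃ : ∀ (x z : ℝ → X) (y w : ℝ → Y), IsSolNL A f g x y → IsSolNL A f g z w →
      ∀ t s, x s = z s → ‖x t - z t‖ + ‖y t - w t‖ ≤ Δ₃ t s * ‖y s - w s‖)
    -- bounds on `f`
    (M N : ℝ) (hM : 1 ≤ M) (hN : 1 ≤ N)
    (ε : ℝ → ℝ) (hεc : Continuous ε) (hεpos : ∀ t, 0 < ε t) (hεN : ∀ t, ε t ≤ N)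
    (hfb : ∀ t x y, ‖f t x y‖ ≤ M)
    (hfl : ∀ (t : ℝ) (x₁ x₂ : X) (y₁ y₂ : Y),
      ‖f t x₁ y₁ - f t x₂ y₂‖ ≤ ε t * (‖x₁ - x₂‖ + ‖y₁ - y₂‖))
    -- integral conditions
    (K q : ℝ)
    (hKint : ∀ t, Integrable fun s => ‖Green T P t s‖)
    (hK : ∀ t, (∫ s, ‖Green T P t s‖) ≤ K)
    (hqint : ∀ t, Integrable fun s => ‖Green T P t s‖ * ε s)
    (hq : ∀ t, (∫ s, ‖Green T P t s‖ * ε s) ≤ q)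
    (hq1 : q < 1)
    -- `h̄` is the conjugacy from the linearization theorem
    (hbar : ℝ → X → Y → X)
    (hbarfix : ∀ (τ : ℝ) (ξ : X) (η : Y), hbar τ ξ η =
      -∫ s, Green T P τ s (f s (Ψ s τ ξ η) (Φ s τ η)))
    -- the Hölder data
    (C α : ℝ) (hC : 0 < C) (hα0 : 0 < α) (hα1 : α < 1)
    (hint : ∀ t, Integrable fun s => ‖Green T P t s‖ * ε s ^ α * Δ₃ s t ^ α)
    (hcond : ∀ t, 2 * M * (∫ s, ‖Green T P t s‖ * ε s ^ α * Δ₃ s t ^ α) ≤ C) :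
    ∀ (t : ℝ) (x : X) (y₁ y₂ : Y), ‖hbar t x y₁ - hbar t x y₂‖ ≤ C * ‖y₁ - y₂‖ ^ α := by
  intro t x y₁ y₂
  have hcont : ∀ y, Continuous fun s => f s (Ψ s t x y) (Φ s t y) := fun y =>
    hf.comp (continuous_id.prodMk
      ((continuous_iff_continuousAt.2 fun s => ((hΨ t x y).1.1 s).continuousAt).prodMk
        (continuous_iff_continuousAt.2 fun s => ((hΨ t x y).1.2 s).continuousAt)))
  have hi : ∀ y, Integrable fun s => Green T P t s (f s (Ψ s t x y) (Φ s t y)) := fun y =>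
    integrable_green_apply hA hT hP (hKint t) (hcont y) fun s => hfb _ _ _
  have hdiff : ∀ s, ‖f s (Ψ s t x y₂) (Φ s t y₂) - f s (Ψ s t x y₁) (Φ s t y₁)‖ ≤
      2 * M * (ε s ^ α * Δ₃ s t ^ α * ‖y₁ - y₂‖ ^ α) := by
    intro s
    have hsol := hΔ₃ _ _ _ _ (hΨ t x y₂).1 (hΨ t x y₁).1 s t
      ((hΨ t x y₂).2.trans (hΨ t x y₁).2.symm)
    simp only [(hΦ t _).2] at hsol
    have hlip := (hfl s (Ψ s t x y₂) (Ψ s t x y₁) (Φ s t y₂) (Φ s t y₁)).trans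
      (mul_le_mul_of_nonneg_left hsol (hεpos s).le)
    have hbd := (norm_sub_le (f s (Ψ s t x y₂) (Φ s t y₂)) (f s (Ψ s t x y₁) (Φ s t y₁))).trans
      (add_le_add (hfb _ _ _) (hfb _ _ _))
    have := Real.le_mul_rpow_of_le_of_le (norm_nonneg _) (by linarith : 1 ≤ 2 * M)
      (by linarith) hlip hα0.le hα1.le
    rwa [Real.mul_rpow (hεpos s).le (mul_nonneg (hΔ₃pos s t).le (norm_nonneg _)),
      Real.mul_rpow (hΔ₃pos s t).le (norm_nonneg _), ← mul_assoc (ε s ^ α),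
      norm_sub_rev y₂ y₁] at this
  have heq : hbar t x y₁ - hbar t x y₂ = ∫ s, Green T P t s
      (f s (Ψ s t x y₂) (Φ s t y₂) - f s (Ψ s t x y₁) (Φ s t y₁)) := by
    simp only [map_sub]
    rw [integral_sub (hi y₂) (hi y₁), hbarfix, hbarfix, neg_sub_neg]
  rw [heq]
  calc _ ≤ ∫ s, ‖Green T P t s‖ * ε s ^ α * Δ₃ s t ^ α * (2 * M * ‖y₁ - y₂‖ ^ α) := by
        refine norm_integral_le_of_norm_le ((hint t).mul_const _)
          (Filter.Eventually.of_forall fun s => ?_)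
        refine ((Green T P t s).le_opNorm_of_le (hdiff s)).trans_eq ?_
        ring
    _ = 2 * M * (∫ s, ‖Green T P t s‖ * ε s ^ α * Δ₃ s t ^ α) * ‖y₁ - y₂‖ ^ α := by
        rw [integral_mul_const]
        ring
    _ ≤ C * ‖y₁ - y₂‖ ^ α := by
        gcongr
        exact hcond t
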